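/- Let q be a prime number. For every complex number s with Re(s) > 1, the Dirichlet series ∑_{n ≥ 1} D(qn)/n^s converges and equals ((2 q^{2s} − q^s)/(2 q^{2s} − 2 q^s + 1)) · ζ(s) · ζ(2s) · ∏_p (1 − 1/(2 p^{2s}) + 1/(2 p^{3s})), where ζ is the Riemann zeta function, the product runs over all primes p, and D(n) = d(n)/d*(n). -/

import Mathlib

open scoped Classical

noncomputable section

/-- Number of unitary divisors of `n`: divisors `e` of `n` with `gcd (e, n/e) = 1`. -/
def dstar (n : ℕ) : ℕ := (n.divisors.filter fun e => Nat.gcd e (n / e) = 1).card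

/-- `D n = d(n) / d*(n)`, as a complex number. -/
def DC (n : ℕ) : ℂ := (n.divisors.card : ℂ) / (dstar n : ℂ)

theorem dstar_mul {m n : ℕ} (hmn : m.Coprime n) : dstar (m * n) = dstar m * dstar n := by
  have key : (m * n).divisors.filter (fun e => Nat.gcd e (m * n / e) = 1) =
      (m.divisors.filter (fun e => Nat.gcd e (m / e) = 1) ×ˢ
        n.divisors.filter (fun e => Nat.gcd e (n / e) = 1)).image (fun p => p.1 * p.2) := by
    have iff_aux : ∀ a b, a ∣ m → b ∣ n →
        (Nat.gcd (a * b) (m * n / (a * b)) = 1 ↔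
          Nat.gcd a (m / a) = 1 ∧ Nat.gcd b (n / b) = 1) := by
      intro a b ha hb
      rw [← Nat.div_mul_div_comm ha hb]
      have h1 : Nat.Coprime a (n / b) :=
        Nat.Coprime.of_dvd ha (Nat.div_dvd_of_dvd hb) hmn
      have h2 : Nat.Coprime b (m / a) :=
        (Nat.Coprime.of_dvd (Nat.div_dvd_of_dvd ha) hb hmn).symm
      change Nat.Coprime _ _ ↔ Nat.Coprime _ _ ∧ Nat.Coprime _ _
      rw [Nat.coprime_mul_iff_left, Nat.coprime_mul_iff_right, Nat.coprime_mul_iff_right]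
      tauto
    ext e
    simp only [Finset.mem_filter, Finset.mem_image, Finset.mem_product, Prod.exists]
    constructor
    · rintro ⟨he, hg⟩
      rw [Nat.divisors_mul, Finset.mem_mul] at he
      obtain ⟨a, ha, b, hb, rfl⟩ := he
      obtain ⟨h1, h2⟩ := (iff_aux a b (Nat.dvd_of_mem_divisors ha)
        (Nat.dvd_of_mem_divisors hb)).1 hg
      exact ⟨a, b, ⟨⟨ha, h1⟩, hb, h2⟩, rfl⟩
    · rintro ⟨a, b, ⟨⟨ha, h1⟩, hb, h2⟩, rfl⟩
      refine ⟨?_, (iff_aux a b (Nat.dvd_of_mem_divisors ha)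
        (Nat.dvd_of_mem_divisors hb)).2 ⟨h1, h2⟩⟩
      rw [Nat.divisors_mul]
      exact Finset.mul_mem_mul ha hb
  unfold dstar
  rw [key, Finset.card_image_of_injOn, Finset.card_product]
  refine hmn.mul_injOn_divisors.mono ?_
  exact_mod_cast Finset.product_subset_product (Finset.filter_subset _ _)
    (Finset.filter_subset _ _)

theorem dstar_one : dstar 1 = 1 := by
  simp [dstar, Finset.filter_singleton]

theorem dstar_prime_pow {p : ℕ} (hp : p.Prime) {k : ℕ} (hk : k ≠ 0) : dstar (p ^ k) = 2 := by
  have key : (p ^ k).divisors.filter (fun e => Nat.gcd e (p ^ k / e) = 1) = {1, p ^ k} := by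
    ext e
    simp only [Finset.mem_filter, Finset.mem_insert, Finset.mem_singleton]
    constructor
    · rintro ⟨he, hg⟩
      obtain ⟨j, hj, rfl⟩ := (Nat.mem_divisors_prime_pow hp k).1 he
      rw [Nat.pow_div hj hp.pos] at hg
      rcases Nat.eq_zero_or_pos j with rfl | hj0
      · simp
      · right
        have h1 : p ^ j = p ^ k ∨ 0 < k - j := by
          rcases hj.eq_or_lt with rfl | h
          · simp
          · right; omega
        rcases h1 with h1 | h1
        · exact h1
        · exfalso
          have : Nat.Coprime (p ^ j) (p ^ (k - j)) := hg
          rw [Nat.coprime_pow_left_iff hj0, Nat.coprime_pow_right_iff h1, Nat.coprime_self] at this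
          exact hp.one_lt.ne' this
    · rintro (rfl | rfl)
      · simp [hp.ne_zero]
      · simp [hp.ne_zero, Nat.div_self (pow_pos hp.pos k)]
  unfold dstar
  rw [key, Finset.card_pair]
  exact (Nat.one_lt_pow hk hp.one_lt).ne

theorem DC_zero : DC 0 = 0 := by simp [DC]

theorem DC_one : DC 1 = 1 := by simp [DC, dstar_one]

theorem DC_mul {m n : ℕ} (hmn : m.Coprime n) : DC (m * n) = DC m * DC n := by
  simp only [DC, dstar_mul hmn, hmn.card_divisors_mul, Nat.cast_mul]
  rw [mul_div_mul_comm]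

theorem DC_prime_pow {p : ℕ} (hp : p.Prime) {k : ℕ} (hk : k ≠ 0) :
    DC (p ^ k) = ((k : ℂ) + 1) / 2 := by
  simp [DC, dstar_prime_pow hp hk, Nat.divisors_prime_pow hp]

theorem DC_prime {p : ℕ} (hp : p.Prime) : DC p = 1 := by
  have := DC_prime_pow hp one_ne_zero
  rw [pow_one] at this
  rw [this]; norm_num

theorem DC_prime_mul_mul {q : ℕ} (hq : q.Prime) {m n : ℕ} (hmn : m.Coprime n) :
    DC (q * (m * n)) = DC (q * m) * DC (q * n) := by
  have aux : ∀ {a b : ℕ}, a.Coprime b → ¬ q ∣ b → DC (q * (a * b)) = DC (q * a) * DC (q * b) := by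
    intro a b hab hb
    have hqb := (Nat.Prime.coprime_iff_not_dvd hq).2 hb
    rw [← mul_assoc, DC_mul (Nat.Coprime.mul_left hqb hab), DC_mul hqb, DC_prime hq, one_mul]
  by_cases hn : q ∣ n
  · have hm : ¬ q ∣ m := fun hm => hq.one_lt.ne' (Nat.eq_one_of_dvd_coprimes hmn hm hn)
    rw [mul_comm m n, aux hmn.symm hm, mul_comm]
  · exact aux hmn hn

theorem hasSum_half_succ_mul_pow {𝕜 : Type*} [RCLike 𝕜] {x : 𝕜} (hx : ‖x‖ < 1) :
    HasSum (fun k : ℕ => if k = 0 then (1 : 𝕜) else ((k : 𝕜) + 1) / 2 * x ^ k)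
      ((2 - 2 * x + x ^ 2) / (2 * (1 - x) ^ 2)) := by
  have h1 : (1 - x) ≠ 0 := by
    intro h
    rw [← sub_eq_zero.1 h] at hx
    simp at hx
  have hs := (((hasSum_coe_mul_geometric_of_norm_lt_one hx).add
    (hasSum_geometric_of_norm_lt_one hx)).mul_left (1 / 2 : 𝕜)).add
      (hasSum_ite_eq (0 : ℕ) (1 / 2 : 𝕜))
  convert! hs using 1
  · funext k
    rcases eq_or_ne k 0 with rfl | hk
    · norm_num
    · simp only [hk, if_false]; ring
  · field_simp
    ring

theorem hasSum_half_add_two_mul_pow {𝕜 : Type*} [RCLike 𝕜] {x : 𝕜} (hx : ‖x‖ < 1) :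
    HasSum (fun k : ℕ => ((k : 𝕜) + 2) / 2 * x ^ k) ((2 - x) / (2 * (1 - x) ^ 2)) := by
  have h1 : (1 - x) ≠ 0 := by
    intro h
    rw [← sub_eq_zero.1 h] at hx
    simp at hx
  have hs := ((hasSum_coe_mul_geometric_of_norm_lt_one hx).mul_left (1 / 2 : 𝕜)).add
    (hasSum_geometric_of_norm_lt_one hx)
  convert! hs using 1
  · funext k
    ring
  · field_simp
    ring

/-- A multiplicative arithmetic function is absolutely summable as soon as its local factors are
bounded by `1 + g p` with `g` summable. -/
theorem summable_norm_of_local_factor_le {f : ℕ → ℂ} (hf0 : f 0 = 0) (hf1 : f 1 = 1)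
    (hmul : ∀ {m n : ℕ}, m.Coprime n → f (m * n) = f m * f n) {g : ℕ → ℝ} (hg : Summable g)
    (hg0 : ∀ n, 0 ≤ g n) (hsum : ∀ {p : ℕ}, p.Prime → Summable fun e : ℕ => ‖f (p ^ e)‖)
    (hle : ∀ {p : ℕ}, p.Prime → ∑' e : ℕ, ‖f (p ^ e)‖ ≤ 1 + g p) :
    Summable fun n => ‖f n‖ := by
  refine summable_of_sum_le (c := Real.exp (∑' n, g n)) (fun n => norm_nonneg _) fun u => ?_
  obtain ⟨N, hN⟩ : ∃ N, ∀ n ∈ u, n < N :=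
    ⟨u.sup id + 1, fun n hn => Nat.lt_succ_of_le (Finset.le_sup (f := id) hn)⟩
  have hS := EulerProduct.summable_and_hasSum_smoothNumbers_prod_primesBelow_tsum
    (f := fun n => ‖f n‖) (by simp [hf1]) (fun h => by simp [hmul h]) (fun hp => by simpa using hsum hp) N
  have hset : HasSum ((Nat.smoothNumbers N).indicator fun n => ‖f n‖)
      (∏ p ∈ N.primesBelow, ∑' e : ℕ, ‖f (p ^ e)‖) :=
    hasSum_subtype_iff_indicator.1 hS.2
  calc ∑ n ∈ u, ‖f n‖ = ∑ n ∈ u, (Nat.smoothNumbers N).indicator (fun n => ‖f n‖) n := by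
        refine Finset.sum_congr rfl fun n hn => ?_
        rcases Nat.eq_zero_or_pos n with rfl | hpos
        · simp [Set.indicator_apply, hf0]
        · rw [Set.indicator_of_mem (Nat.mem_smoothNumbers_of_lt hpos (hN n hn))]
    _ ≤ ∏ p ∈ N.primesBelow, ∑' e : ℕ, ‖f (p ^ e)‖ :=
        sum_le_hasSum _ (fun n _ => Set.indicator_nonneg (fun _ _ => norm_nonneg _) n) hset
    _ ≤ ∏ p ∈ N.primesBelow, (1 + g p) :=
        Finset.prod_le_prod (fun p _ => tsum_nonneg fun _ => norm_nonneg _)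
          fun p hp => hle (Nat.prime_of_mem_primesBelow hp)
    _ ≤ Real.exp (∑ p ∈ N.primesBelow, g p) := Real.prod_one_add_le_exp_sum _ hg0
    _ ≤ Real.exp (∑' n, g n) := Real.exp_le_exp.2 (hg.sum_le_tsum _ fun n _ => hg0 n)

theorem norm_natCast_cpow_neg_le_half {n : ℕ} (hn : 2 ≤ n) {s : ℂ} (hs : 1 < s.re) :
    ‖(n : ℂ) ^ (-s)‖ ≤ 1 / 2 := by
  have h2 : (2 : ℝ) ≤ n := by exact_mod_cast hn
  rw [Complex.norm_natCast_cpow_of_pos (by omega), Complex.neg_re]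
  calc (n : ℝ) ^ (-s.re) ≤ (n : ℝ) ^ (-1 : ℝ) :=
        Real.rpow_le_rpow_of_exponent_le (by linarith) (by linarith)
    _ = 1 / n := by rw [Real.rpow_neg_one, one_div]
    _ ≤ 1 / 2 := one_div_le_one_div_of_le two_pos h2

theorem natCast_pow_cpow_neg (p e : ℕ) (s : ℂ) :
    ((p ^ e : ℕ) : ℂ) ^ (-s) = ((p : ℂ) ^ (-s)) ^ e := by
  rw [← Complex.cpow_nat_mul, Complex.natCast_cpow_natCast_mul, Nat.cast_pow]

theorem summable_norm_natCast_cpow_neg {s : ℂ} (hs : 1 < s.re) :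
    Summable fun n : ℕ => ‖(n : ℂ) ^ (-s)‖ := by
  simpa [riemannZetaSummandHom] using summable_riemannZetaSummand hs

theorem DC_prime_pow_mul_cpow {p : ℕ} (hp : p.Prime) (e : ℕ) (s : ℂ) :
    DC (p ^ e) * ((p ^ e : ℕ) : ℂ) ^ (-s) =
      if e = 0 then 1 else ((e : ℂ) + 1) / 2 * ((p : ℂ) ^ (-s)) ^ e := by
  rcases eq_or_ne e 0 with rfl | he
  · simp [DC_one]
  · rw [if_neg he, DC_prime_pow hp he, natCast_pow_cpow_neg]

theorem summable_norm_DC_mul_cpow {s : ℂ} (hs : 1 < s.re) :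
    Summable fun n : ℕ => ‖DC n * (n : ℂ) ^ (-s)‖ := by
  have hnorm : ∀ {p : ℕ}, p.Prime → HasSum (fun e : ℕ => ‖DC (p ^ e) * ((p ^ e : ℕ) : ℂ) ^ (-s)‖)
      ((2 - 2 * ‖(p : ℂ) ^ (-s)‖ + ‖(p : ℂ) ^ (-s)‖ ^ 2) /
        (2 * (1 - ‖(p : ℂ) ^ (-s)‖) ^ 2)) := by
    intro p hp
    have hx := norm_natCast_cpow_neg_le_half hp.two_le hs
    convert! hasSum_half_succ_mul_pow (𝕜 := ℝ) (x := ‖(p : ℂ) ^ (-s)‖)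
      (by rw [norm_norm]; linarith) using 1
    funext e
    rw [DC_prime_pow_mul_cpow hp]
    split_ifs
    · simp
    · have : ‖(e : ℂ) + 1‖ = (e : ℝ) + 1 := by
        exact_mod_cast Complex.norm_natCast (e + 1)
      simp [this]
  refine summable_norm_of_local_factor_le (g := fun n => 4 * ‖(n : ℂ) ^ (-s)‖)
    (by simp [DC_zero]) (by simp [DC_one]) (fun {m n} h => ?_)
    ((summable_norm_natCast_cpow_neg hs).mul_left 4) (fun n => by positivity)
    (fun hp => (hnorm hp).summable) (fun {p} hp => ?_)
  · rw [DC_mul h, Nat.cast_mul, Complex.natCast_mul_natCast_cpow]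
    ring
  · rw [(hnorm hp).tsum_eq]
    have hx := norm_natCast_cpow_neg_le_half hp.two_le hs
    have hx0 := norm_nonneg ((p : ℂ) ^ (-s))
    generalize ‖(p : ℂ) ^ (-s)‖ = x at hx hx0
    have h1 : 0 < 1 - x := by linarith
    rw [div_le_iff₀ (by positivity)]
    nlinarith [mul_nonneg hx0 (sub_nonneg.2 hx), mul_nonneg (mul_nonneg hx0 hx0) (sub_nonneg.2 hx),
      mul_nonneg hx0 (mul_nonneg (sub_nonneg.2 hx) (sub_nonneg.2 hx))]

theorem summable_norm_DC_mul_mul_cpow {q : ℕ} (hq : q ≠ 0) {s : ℂ} (hs : 1 < s.re) :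
    Summable fun n : ℕ => ‖DC (q * n) * (n : ℂ) ^ (-s)‖ := by
  have h := ((summable_norm_DC_mul_cpow hs).comp_injective
    (mul_right_injective₀ hq)).mul_left ‖((q : ℂ) ^ (-s))⁻¹‖
  refine h.congr fun n => ?_
  have hq0 : (q : ℂ) ^ (-s) ≠ 0 := by
    rw [Complex.cpow_def_of_ne_zero (by exact_mod_cast hq)]
    exact Complex.exp_ne_zero _
  rw [Function.comp_apply, ← norm_mul, Nat.cast_mul, Complex.natCast_mul_natCast_cpow]
  congr 1
  field_simp

/-- The local factor at `p` of the Euler product of `∑ D(q n) n⁻ˢ`, in terms of `x = p⁻ˢ`. -/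
theorem hasSum_DC_mul_prime_pow {q : ℕ} (hq : q.Prime) {p : ℕ} (hp : p.Prime) {s : ℂ}
    (hs : 1 < s.re) :
    HasSum (fun e : ℕ => DC (q * p ^ e) * ((p ^ e : ℕ) : ℂ) ^ (-s))
      (if p = q then (2 - (p : ℂ) ^ (-s)) / (2 * (1 - (p : ℂ) ^ (-s)) ^ 2)
        else (2 - 2 * (p : ℂ) ^ (-s) + ((p : ℂ) ^ (-s)) ^ 2) /
          (2 * (1 - (p : ℂ) ^ (-s)) ^ 2)) := by
  have hx : ‖(p : ℂ) ^ (-s)‖ < 1 := by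
    linarith [norm_natCast_cpow_neg_le_half hp.two_le hs]
  split_ifs with h
  · subst h
    convert! hasSum_half_add_two_mul_pow hx using 1
    funext e
    rw [natCast_pow_cpow_neg, ← pow_succ', DC_prime_pow hp e.succ_ne_zero]
    push_cast
    ring
  · convert! hasSum_half_succ_mul_pow hx using 1
    funext e
    rw [DC_mul (((Nat.coprime_primes hq hp).2 (Ne.symm h)).pow_right e), DC_prime hq, one_mul,
      DC_prime_pow_mul_cpow hp]

theorem multipliable_one_sub_add (s : ℂ) (hs : 1 < s.re) :
    Multipliable fun p : Nat.Primes =>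
      (1 - 1 / (2 * (p : ℂ) ^ (2 * s)) + 1 / (2 * (p : ℂ) ^ (3 * s))) := by
  have hsum : ∀ k : ℕ, 1 < k → Summable fun p : Nat.Primes => ‖1 / (2 * (p : ℂ) ^ (k * s))‖ := by
    intro k hk
    have hk' : (1 : ℝ) < k := by exact_mod_cast hk
    have h := ((summable_norm_natCast_cpow_neg (s := k * s) (by
      rw [← Complex.ofReal_natCast, Complex.re_ofReal_mul]; nlinarith)).comp_injective
        Nat.Primes.coe_nat_injective).mul_left (1 / 2)
    refine h.congr fun p => ?_
    simp [Complex.cpow_neg, mul_comm]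
  have h := multipliable_one_add_of_summable (R := ℂ)
    (f := fun p : Nat.Primes => -(1 / (2 * (p : ℂ) ^ (2 * s))) + 1 / (2 * (p : ℂ) ^ (3 * s)))
    (Summable.of_nonneg_of_le (fun _ => norm_nonneg _) (fun _ => norm_add_le _ _)
      (by simpa using (hsum 2 (by norm_num)).add (hsum 3 (by norm_num))))
  refine h.congr fun p => ?_
  ring

theorem two_sub_two_mul_add_sq_ne_zero {x : ℂ} (hx : ‖x‖ ≤ 1 / 2) : 2 - 2 * x + x ^ 2 ≠ 0 := by
  intro h
  have h1 : ‖2 * x - x ^ 2‖ = 2 := by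
    rw [show 2 * x - x ^ 2 = 2 by linear_combination -h]; norm_num
  have h2 : ‖2 * x - x ^ 2‖ ≤ 2 * ‖x‖ + ‖x‖ ^ 2 := by
    refine (norm_sub_le _ _).trans_eq ?_
    rw [norm_mul, norm_pow, Complex.norm_two]
  nlinarith [norm_nonneg x]

theorem local_factor_eq {x : ℂ} (hx : ‖x‖ ≤ 1 / 2) :
    (2 - 2 * x + x ^ 2) / (2 * (1 - x) ^ 2) = (1 - x)⁻¹ * (1 - (x⁻¹ ^ 2)⁻¹)⁻¹ *
      (1 - 1 / (2 * x⁻¹ ^ 2) + 1 / (2 * x⁻¹ ^ 3)) := by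
  have hn1 : 1 - x ≠ 0 := by
    intro h
    rw [← sub_eq_zero.1 h] at hx
    norm_num at hx
  have hn2 : 1 + x ≠ 0 := by
    intro h
    rw [eq_neg_of_add_eq_zero_right h] at hx
    norm_num at hx
  have hn3 : 1 - x ^ 2 ≠ 0 := by
    rw [show 1 - x ^ 2 = (1 - x) * (1 + x) by ring]
    exact mul_ne_zero hn1 hn2
  simp only [inv_pow, inv_inv]
  field_simp
  ring

theorem local_factor_ratio_eq {x : ℂ} (hx : ‖x‖ ≤ 1 / 2) (hx0 : x ≠ 0) :
    (2 - x) / (2 * (1 - x) ^ 2) = (2 * x⁻¹ ^ 2 - x⁻¹) / (2 * x⁻¹ ^ 2 - 2 * x⁻¹ + 1) *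
      ((2 - 2 * x + x ^ 2) / (2 * (1 - x) ^ 2)) := by
  have h := two_sub_two_mul_add_sq_ne_zero hx
  have hnum : 2 * x⁻¹ ^ 2 - x⁻¹ = (2 - x) / x ^ 2 := by
    field_simp
  have hden : 2 * x⁻¹ ^ 2 - 2 * x⁻¹ + 1 = (2 - 2 * x + x ^ 2) / x ^ 2 := by
    field_simp
  rw [hnum, hden, div_div_div_cancel_right₀ (pow_ne_zero 2 hx0), div_mul_div_cancel₀ h]

theorem dirichlet_series_DD_mul_prime (q : ℕ) (hq : q.Prime) (s : ℂ) (hs : 1 < s.re) :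
    HasSum (fun n : ℕ+ => DC (q * n) / (n : ℂ) ^ s)
      (((2 * (q : ℂ) ^ (2 * s) - (q : ℂ) ^ s) / (2 * (q : ℂ) ^ (2 * s) - 2 * (q : ℂ) ^ s + 1)) *
        (riemannZeta s * riemannZeta (2 * s) *
          ∏' p : Nat.Primes, (1 - 1 / (2 * (p : ℂ) ^ (2 * s)) + 1 / (2 * (p : ℂ) ^ (3 * s))))) := by
  set R : ℂ :=
    (2 * (q : ℂ) ^ (2 * s) - (q : ℂ) ^ s) / (2 * (q : ℂ) ^ (2 * s) - 2 * (q : ℂ) ^ s + 1) with hR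
  have hsum := summable_norm_DC_mul_mul_cpow hq.ne_zero hs
  have hprod := EulerProduct.eulerProduct_hasProd
    (f := fun n : ℕ => DC (q * n) * (n : ℂ) ^ (-s)) (by simp [DC_prime hq])
    (fun {m n} h => by
      simp only [DC_prime_mul_mul hq h, Nat.cast_mul, Complex.natCast_mul_natCast_cpow]
      ring) hsum (by simp [DC_zero])
  have hs2 : 1 < (2 * s).re := by
    simp; linarith
  have hc : HasProd (fun p : Nat.Primes => if (p : ℕ) = q then R else 1) R := by
    simpa using hasProd_single (f := fun p : Nat.Primes => if (p : ℕ) = q then R else 1) ⟨q, hq⟩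
      fun p hp => if_neg fun h => hp (Subtype.ext h)
  have hrhs := hc.mul
    (((riemannZeta_eulerProduct_hasProd hs).mul (riemannZeta_eulerProduct_hasProd hs2)).mul
      (multipliable_one_sub_add s hs).hasProd)
  have heq : (fun p : Nat.Primes => ∑' e : ℕ, DC (q * (p : ℕ) ^ e) *
      (((p : ℕ) ^ e : ℕ) : ℂ) ^ (-s)) = fun p : Nat.Primes =>
        (if (p : ℕ) = q then R else 1) * ((1 - (p : ℂ) ^ (-s))⁻¹ * (1 - (p : ℂ) ^ (-(2 * s)))⁻¹ *
          (1 - 1 / (2 * (p : ℂ) ^ (2 * s)) + 1 / (2 * (p : ℂ) ^ (3 * s)))) := by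
    funext p
    obtain ⟨p, hp⟩ := p
    rw [(hasSum_DC_mul_prime_pow hq hp hs).tsum_eq]
    have hx := norm_natCast_cpow_neg_le_half hp.two_le hs
    have h2 : (p : ℂ) ^ (2 * s) = ((p : ℂ) ^ s) ^ 2 := by
      rw [← Complex.cpow_nat_mul]; norm_num
    have h3 : (p : ℂ) ^ (3 * s) = ((p : ℂ) ^ s) ^ 3 := by
      rw [← Complex.cpow_nat_mul]; norm_num
    have hp0 : (p : ℂ) ^ s ≠ 0 := by
      rw [Complex.cpow_def_of_ne_zero (by exact_mod_cast hp.ne_zero)]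
      exact Complex.exp_ne_zero _
    have hpx : (p : ℂ) ^ s = ((p : ℂ) ^ (-s))⁻¹ := by rw [Complex.cpow_neg, inv_inv]
    have hx0 : (p : ℂ) ^ (-s) ≠ 0 := by rw [Complex.cpow_neg]; exact inv_ne_zero hp0
    simp only [Complex.cpow_neg _ (2 * s), h2, h3]
    have hRp : p = q → R = (2 * ((p : ℂ) ^ s) ^ 2 - (p : ℂ) ^ s) /
        (2 * ((p : ℂ) ^ s) ^ 2 - 2 * (p : ℂ) ^ s + 1) := by
      rintro rfl
      rw [hR, h2]
    rw [hpx] at hRp ⊢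
    generalize (p : ℂ) ^ (-s) = x at hx hx0 hRp
    rw [← local_factor_eq hx]
    split_ifs with h
    · rw [hRp h, local_factor_ratio_eq hx hx0]
    · rw [one_mul]
  rw [← heq] at hrhs
  have htsum := hrhs.unique hprod
  rw [htsum]
  have hN := hsum.of_norm.hasSum
  rw [← PNat.coe_injective.hasSum_iff] at hN
  · convert! hN using 1
    funext n
    simp [Complex.cpow_neg, div_eq_mul_inv]
  · intro n hn
    have : n = 0 := by
      by_contra h
      exact hn ⟨⟨n, Nat.pos_of_ne_zero h⟩, rfl⟩
    simp [this, DC_zero]
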